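/- Let n ≥ 1 and d be integers with |d| ≥ 2, and let φ : S(n,d) → Σ(n,d) be the injective group homomorphism induced by multiplication by x − 1. Then the quotient group Σ(n,d)/φ(S(n,d)) is isomorphic to ℤ/n; in particular |Σ(n,d)| = n·|S(n,d)|. -/

import Mathlib

open Finset

noncomputable section

/-- The ring `ℤ[x]/(x^n - 1)`, realized as the group algebra `ℤ[ℤ/n]`;
the class of `x^j` (for `j : ℤ`) corresponds to `xp n (j : ZMod n)`. -/
abbrev Rn (n : ℕ) : Type := AddMonoidAlgebra ℤ (ZMod n)

/-- The class of `x^w` in `ℤ[x]/(x^n - 1)`. -/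
def xp (n : ℕ) (w : ZMod n) : Rn n := AddMonoidAlgebra.single w 1

/-- `e_v = x^v - 1`. -/
def eV (n : ℕ) (w : ZMod n) : Rn n := xp n w - 1

/-- `ε_v = d·e_v - e_{d·v}`. -/
def epsV (n : ℕ) (d : ℤ) (w : ZMod n) : Rn n := d • eV n w - eV n ((d : ZMod n) * w)

/-- `𝒵_n`, the ℤ-span of the `e_v`, `1 ≤ v ≤ n-1`. -/
def ZSpan (n : ℕ) : Submodule ℤ (Rn n) :=
  Submodule.span ℤ {a : Rn n | ∃ v : ℤ, 1 ≤ v ∧ v ≤ (n : ℤ) - 1 ∧ a = eV n (v : ZMod n)}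

/-- `ℰ_{n,d}`, the ℤ-span of the `ε_v`, `1 ≤ v ≤ n-1`. -/
def ESpan (n : ℕ) (d : ℤ) : Submodule ℤ (Rn n) :=
  Submodule.span ℤ {a : Rn n | ∃ v : ℤ, 1 ≤ v ∧ v ≤ (n : ℤ) - 1 ∧ a = epsV n d (v : ZMod n)}

/-- `1 + x + ⋯ + x^{|d|-1}`. -/
def geomT (n : ℕ) (d : ℤ) : Rn n := ∑ i ∈ Finset.range d.natAbs, xp n (i : ZMod n)

/-- `f_v`: the Laplacian row polynomial of `DB(n,d)` (for `d ≥ 0`) resp. of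
`Ktz(n,|d|)` (for `d < 0`). -/
def fV (n : ℕ) (d : ℤ) (v : ℤ) : Rn n :=
  if 0 ≤ d then d • xp n ((v : ZMod n)) - xp n (((d * v : ℤ) : ZMod n)) * geomT n d
  else d • xp n ((v : ZMod n)) + xp n (((d * (v + 1) : ℤ) : ZMod n)) * geomT n d

/-- `F_{n,d}`, the ℤ-span of the `f_v`, `1 ≤ v ≤ n-1`. -/
def FSpan (n : ℕ) (d : ℤ) : Submodule ℤ (Rn n) :=
  Submodule.span ℤ {a : Rn n | ∃ v : ℤ, 1 ≤ v ∧ v ≤ (n : ℤ) - 1 ∧ a = fV n d v}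

/-- The sand dune group `Σ(n,d) = 𝒵_n / ℰ_{n,d}`. -/
abbrev SandDune (n : ℕ) (d : ℤ) :=
  ZSpan n ⧸ Submodule.comap (ZSpan n).subtype (ESpan n d)

/-- The sandpile (critical) group `S(n,d) = 𝒵_n / F_{n,d}`. -/
abbrev Sandpile (n : ℕ) (d : ℤ) :=
  ZSpan n ⧸ Submodule.comap (ZSpan n).subtype (FSpan n d)

theorem eV_zero (n : ℕ) : eV n 0 = 0 := by
  simp [eV, xp, AddMonoidAlgebra.one_def]

theorem eV_mem_ZSpan (n : ℕ) [NeZero n] (w : ZMod n) : eV n w ∈ ZSpan n := by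
  by_cases hw : w = 0
  · rw [hw, eV_zero]
    exact zero_mem _
  · refine Submodule.subset_span ⟨(w.val : ℤ), ?_, ?_, by simp⟩
    · have := ZMod.val_pos.2 hw
      omega
    · have := w.val_lt
      omega

theorem xp_one_sub_one_mul_eV (n : ℕ) (w : ZMod n) :
    (xp n 1 - 1) * eV n w = eV n (w + 1) - eV n w - eV n 1 := by
  have h : xp n 1 * xp n w = xp n (w + 1) := by
    simp [xp, AddMonoidAlgebra.single_mul_single, add_comm]
  simp only [eV, ← h]
  ring

/-- The submodule `(x - 1)·𝒵_n`. -/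
def shiftZSpan (n : ℕ) : Submodule ℤ (Rn n) :=
  (ZSpan n).map (LinearMap.mulLeft ℤ (xp n 1 - 1))

theorem eV_natCast_sub_mem_shiftZSpan (n : ℕ) [NeZero n] (k : ℕ) :
    eV n (k : ZMod n) - (k : ℤ) • eV n 1 ∈ shiftZSpan n := by
  induction k with
  | zero => simp [eV_zero]
  | succ k ih =>
    have h : (xp n 1 - 1) * eV n (k : ZMod n) ∈ shiftZSpan n :=
      Submodule.mem_map_of_mem (f := LinearMap.mulLeft ℤ (xp n 1 - 1)) (eV_mem_ZSpan n k)
    rw [xp_one_sub_one_mul_eV] at h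
    convert add_mem ih h using 1
    push_cast
    module

theorem natCast_smul_eV_one_mem_shiftZSpan (n : ℕ) [NeZero n] :
    (n : ℤ) • eV n 1 ∈ shiftZSpan n := by
  have h := eV_natCast_sub_mem_shiftZSpan n n
  rw [ZMod.natCast_self, eV_zero, zero_sub] at h
  exact neg_mem_iff.1 h

theorem exists_sub_smul_eV_one_mem_shiftZSpan (n : ℕ) [NeZero n] {a : Rn n}
    (ha : a ∈ ZSpan n) : ∃ k : ℤ, a - k • eV n 1 ∈ shiftZSpan n := by
  induction ha using Submodule.span_induction with
  | mem x hx =>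
    obtain ⟨v, hv, -, rfl⟩ := hx
    lift v to ℕ using by omega
    exact ⟨v, by simpa using eV_natCast_sub_mem_shiftZSpan n v⟩
  | zero => exact ⟨0, by simp⟩
  | add x y _ _ hx hy =>
    obtain ⟨k, hk⟩ := hx
    obtain ⟨l, hl⟩ := hy
    refine ⟨k + l, ?_⟩
    convert add_mem hk hl using 1
    module
  | smul c x _ hx =>
    obtain ⟨k, hk⟩ := hx
    refine ⟨c * k, ?_⟩
    convert Submodule.smul_mem _ c hk using 1
    module

/-- The `ℤ`-linear map `ℤ[ℤ/n] → ℤ/n` sending the class of `x^w` to `w`. -/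
def exponentSum (n : ℕ) : Rn n →ₗ[ℤ] ZMod n :=
  Finsupp.linearCombination ℤ (id : ZMod n → ZMod n) ∘ₗ
    (AddMonoidAlgebra.coeffLinearEquiv ℤ).toLinearMap

theorem exponentSum_eV (n : ℕ) (w : ZMod n) : exponentSum n (eV n w) = w := by
  simp [exponentSum, eV, xp, AddMonoidAlgebra.one_def]

theorem exponentSum_epsV (n : ℕ) (d : ℤ) (w : ZMod n) : exponentSum n (epsV n d w) = 0 := by
  rw [epsV, map_sub, map_smul, exponentSum_eV, exponentSum_eV, zsmul_eq_mul, sub_self]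

theorem ESpan_le_ker_exponentSum (n : ℕ) (d : ℤ) :
    ESpan n d ≤ LinearMap.ker (exponentSum n) := by
  refine Submodule.span_le.2 ?_
  rintro _ ⟨v, -, -, rfl⟩
  exact exponentSum_epsV n d v

theorem shiftZSpan_le_ker_exponentSum (n : ℕ) :
    shiftZSpan n ≤ LinearMap.ker (exponentSum n) := by
  refine Submodule.map_le_iff_le_comap.2 (Submodule.span_le.2 ?_)
  rintro _ ⟨v, -, -, rfl⟩
  simp [xp_one_sub_one_mul_eV, exponentSum_eV]

theorem shiftZSpan_le_ZSpan (n : ℕ) [NeZero n] : shiftZSpan n ≤ ZSpan n := by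
  refine Submodule.map_le_iff_le_comap.2 (Submodule.span_le.2 ?_)
  rintro _ ⟨v, -, -, rfl⟩
  simp only [Submodule.comap_coe, Set.mem_preimage, LinearMap.mulLeft_apply, SetLike.mem_coe,
    xp_one_sub_one_mul_eV]
  exact sub_mem (sub_mem (eV_mem_ZSpan n _) (eV_mem_ZSpan n _)) (eV_mem_ZSpan n _)

theorem mem_shiftZSpan_of_exponentSum_eq_zero (n : ℕ) [NeZero n] {a : Rn n}
    (ha : a ∈ ZSpan n) (h : exponentSum n a = 0) : a ∈ shiftZSpan n := by
  obtain ⟨k, hk⟩ := exists_sub_smul_eV_one_mem_shiftZSpan n ha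
  have hk0 : exponentSum n (a - k • eV n 1) = 0 := shiftZSpan_le_ker_exponentSum n hk
  rw [map_sub, map_smul, h, exponentSum_eV, zero_sub, neg_eq_zero, zsmul_one,
    ZMod.intCast_zmod_eq_zero_iff_dvd] at hk0
  obtain ⟨c, rfl⟩ := hk0
  have hc := Submodule.smul_mem _ c (natCast_smul_eV_one_mem_shiftZSpan n)
  convert add_mem hk hc using 1
  module

/-- The homomorphism `Σ(n,d) → ℤ/n` induced by `exponentSum`. -/
def sandDuneExponent (n : ℕ) (d : ℤ) : SandDune n d →ₗ[ℤ] ZMod n :=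
  Submodule.liftQ _ (exponentSum n ∘ₗ (ZSpan n).subtype) fun a ha =>
    ESpan_le_ker_exponentSum n d (x := (a : Rn n)) ha

theorem sandDuneExponent_mk (n : ℕ) (d : ℤ) (a : ZSpan n) :
    sandDuneExponent n d (Submodule.Quotient.mk a) = exponentSum n a := rfl

theorem sandDuneExponent_surjective (n : ℕ) [NeZero n] (d : ℤ) :
    Function.Surjective (sandDuneExponent n d) := fun w =>
  ⟨Submodule.Quotient.mk ⟨eV n w, eV_mem_ZSpan n w⟩, exponentSum_eV n w⟩

/-- for the injective homomorphism `φ : S(n,d) → Σ(n,d)` induced by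
multiplication by `x − 1`, the quotient `Σ(n,d)/φ(S(n,d))` is isomorphic to `ℤ/n`;
in particular `|Σ(n,d)| = n·|S(n,d)|`. -/
theorem stmt4 (n : ℕ) (d : ℤ) (hn : 1 ≤ n) (hd : 2 ≤ |d|)
    (φ : Sandpile n d →+ SandDune n d)
    (hinj : Function.Injective φ)
    (hφ : ∀ (a : Rn n) (ha : a ∈ ZSpan n) (hb : (xp n 1 - 1) * a ∈ ZSpan n),
      φ ((Submodule.Quotient.mk ⟨a, ha⟩ : Sandpile n d)) =
        (Submodule.Quotient.mk ⟨(xp n 1 - 1) * a, hb⟩ : SandDune n d)) :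
    Nonempty ((SandDune n d ⧸ φ.range) ≃+ ZMod n) ∧
    Nat.card (SandDune n d) = n * Nat.card (Sandpile n d) := by
  have : NeZero n := ⟨by omega⟩
  have hker : (sandDuneExponent n d).toAddMonoidHom.ker = φ.range := by
    ext y
    constructor
    · intro hy
      induction y using Submodule.Quotient.induction_on with
      | H a =>
        obtain ⟨b, hb, hba⟩ := mem_shiftZSpan_of_exponentSum_eq_zero n a.2 hy
        have hb' : (xp n 1 - 1) * b = a := hba
        exact ⟨Submodule.Quotient.mk ⟨b, hb⟩, (hφ b hb (hb' ▸ a.2)).trans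
          (congrArg Submodule.Quotient.mk (Subtype.ext hb'))⟩
    · rintro ⟨s, rfl⟩
      induction s using Submodule.Quotient.induction_on with
      | H b =>
        have hb : (xp n 1 - 1) * (b : Rn n) ∈ shiftZSpan n :=
          Submodule.mem_map_of_mem (f := LinearMap.mulLeft ℤ (xp n 1 - 1)) b.2
        rw [hφ b b.2 (shiftZSpan_le_ZSpan n hb)]
        exact shiftZSpan_le_ker_exponentSum n hb
  let e : (SandDune n d ⧸ φ.range) ≃+ ZMod n :=
    (QuotientAddGroup.quotientAddEquivOfEq hker.symm).trans
      (QuotientAddGroup.quotientKerEquivOfSurjective _ (sandDuneExponent_surjective n d))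
  refine ⟨⟨e⟩, ?_⟩
  rw [AddSubgroup.card_eq_card_quotient_mul_card_addSubgroup φ.range, Nat.card_congr e.toEquiv,
    Nat.card_zmod, Nat.card_congr (AddMonoidHom.ofInjective hinj).toEquiv]
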